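/- For all a, b, c > 0 with 3a + b > c, the random variable X_{a,b,c,2} does not exist; that is, there is no probability measure μ on (0,∞) with ∫ x^s dμ(x) = (Γ(c)/(Γ(a)·Γ(b)))·Γ(a+s)·Γ(b−s)/Γ(c+2s) for every s ∈ (−a, b). -/

import Mathlib

open MeasureTheory Real

/-- `μ` is a law of the random variable `X_{a,b,c,d}`: a probability measure on `(0,∞)`
whose fractional moments are `Γ(c)/(Γ(a)Γ(b)) · Γ(a+s)Γ(b−s)/Γ(c+d·s)` for `s ∈ (−a,b)`. -/
def IsXLaw (a b c d : ℝ) (μ : Measure ℝ) : Prop :=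
  IsProbabilityMeasure μ ∧ μ (Set.Ioi (0 : ℝ))ᶜ = 0 ∧
    ∀ s ∈ Set.Ioo (-a) b,
      ∫⁻ x, ENNReal.ofReal (x ^ s) ∂μ =
        ENNReal.ofReal (Real.Gamma c / (Real.Gamma a * Real.Gamma b) *
          (Real.Gamma (a + s) * Real.Gamma (b - s) / Real.Gamma (c + d * s)))

/-- The random variable `X_{a,b,c,d}` exists. -/
def XExists (a b c d : ℝ) : Prop :=
  ∃ μ : Measure ℝ, IsXLaw a b c d μ

open Set ProbabilityTheory

/-- Two holomorphic functions that agree on an open interval of the real line agree on the vertical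
strip above it. -/
lemma eqOn_strip_of_eqOn_real {f g : ℂ → ℂ} {S : Set ℝ} (hSo : IsOpen S) (hSc : Convex ℝ S)
    (hf : DifferentiableOn ℂ f {z | z.re ∈ S}) (hg : DifferentiableOn ℂ g {z | z.re ∈ S})
    (h : ∀ x ∈ S, f (x : ℂ) = g x) : EqOn f g {z | z.re ∈ S} := by
  rcases S.eq_empty_or_nonempty with rfl | ⟨t, ht⟩
  · simp
  have hopen : IsOpen {z : ℂ | z.re ∈ S} := hSo.preimage Complex.continuous_re
  refine AnalyticOnNhd.eqOn_of_preconnected_of_frequently_eq (hf.analyticOnNhd hopen)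
    (hg.analyticOnNhd hopen) (hSc.linear_preimage Complex.reLm).isPreconnected
    (z₀ := (t : ℂ)) (by simpa using ht) ?_
  have h_real : ∃ᶠ x : ℝ in nhdsWithin t {t}ᶜ, f (x : ℂ) = g x :=
    (Filter.Eventually.filter_mono nhdsWithin_le_nhds
      (Filter.mem_of_superset (hSo.mem_nhds ht) h)).frequently
  have htend : Filter.Tendsto (fun x : ℝ => (x : ℂ)) (nhdsWithin t {t}ᶜ)
      (nhdsWithin (t : ℂ) {(t : ℂ)}ᶜ) := by
    refine tendsto_nhdsWithin_iff.2 ⟨?_, ?_⟩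
    · exact (Complex.continuous_ofReal.tendsto t).mono_left nhdsWithin_le_nhds
    · filter_upwards [self_mem_nhdsWithin] with x hx
      simpa using hx
  exact htend.frequently h_real

lemma mem_integrableExpSet_of_lintegral_ne_top {Ω : Type*} {m : MeasurableSpace Ω}
    {μ : Measure Ω} {X : Ω → ℝ} (hX : AEMeasurable X μ) {t : ℝ}
    (h : ∫⁻ ω, ENNReal.ofReal (exp (t * X ω)) ∂μ ≠ ⊤) : t ∈ integrableExpSet X μ := by
  refine (lintegral_ofReal_ne_top_iff_integrable ?_ ?_).1 h
  · exact (measurable_exp.comp_aemeasurable (hX.const_mul t)).aestronglyMeasurable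
  · exact Filter.Eventually.of_forall fun ω => (exp_pos _).le

lemma mgf_eq_toReal_lintegral {Ω : Type*} {m : MeasurableSpace Ω}
    {μ : Measure Ω} {X : Ω → ℝ} (hX : AEMeasurable X μ) (t : ℝ) :
    mgf X μ t = (∫⁻ ω, ENNReal.ofReal (exp (t * X ω)) ∂μ).toReal := by
  refine integral_eq_lintegral_of_nonneg_ae ?_ ?_
  · exact Filter.Eventually.of_forall fun ω => (exp_pos _).le
  · exact (measurable_exp.comp_aemeasurable (hX.const_mul t)).aestronglyMeasurable

/-- Exponential moments on an interval around `0` determine the distribution. -/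
lemma map_eq_map_of_lintegral_exp_eq {Ω : Type*} {m : MeasurableSpace Ω} {μ ν : Measure Ω}
    [IsFiniteMeasure μ] [IsFiniteMeasure ν] {X : Ω → ℝ} (hX : Measurable X) {u v : ℝ}
    (hu : u < 0) (hv : 0 < v)
    (h : ∀ t ∈ Ioo u v, ∫⁻ ω, ENNReal.ofReal (exp (t * X ω)) ∂μ =
      ∫⁻ ω, ENNReal.ofReal (exp (t * X ω)) ∂ν)
    (hfin : ∀ t ∈ Ioo u v, ∫⁻ ω, ENNReal.ofReal (exp (t * X ω)) ∂μ ≠ ⊤) :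
    μ.map X = ν.map X := by
  have hμ : Ioo u v ⊆ interior (integrableExpSet X μ) :=
    interior_maximal (fun t ht => mem_integrableExpSet_of_lintegral_ne_top hX.aemeasurable
      (hfin t ht)) isOpen_Ioo
  have hν : Ioo u v ⊆ interior (integrableExpSet X ν) :=
    interior_maximal (fun t ht => mem_integrableExpSet_of_lintegral_ne_top hX.aemeasurable
      (h t ht ▸ hfin t ht)) isOpen_Ioo
  have key : EqOn (complexMGF X μ) (complexMGF X ν) {z | z.re ∈ Ioo u v} := by
    refine eqOn_strip_of_eqOn_real isOpen_Ioo (convex_Ioo u v)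
      (differentiableOn_complexMGF.mono fun z hz => hμ hz)
      (differentiableOn_complexMGF.mono fun z hz => hν hz) fun t ht => ?_
    rw [complexMGF_ofReal, complexMGF_ofReal, mgf_eq_toReal_lintegral hX.aemeasurable,
      mgf_eq_toReal_lintegral hX.aemeasurable, h t ht]
  refine Measure.ext_of_charFun (funext fun t => ?_)
  rw [← complexMGF_mul_I hX.aemeasurable, ← complexMGF_mul_I hX.aemeasurable]
  exact key (by simp [hu, hv])

/-- A function on `(0, ∞)` is determined almost everywhere by its Mellin transform on a
real interval. -/
lemma ae_eq_of_lintegral_mul_rpow_eq {f g : ℝ → ENNReal} (hf : Measurable f) (hg : Measurable g)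
    {u v : ℝ} (hu : u < 0) (hv : 0 < v)
    (h : ∀ t ∈ Ioo u v, ∫⁻ p in Ioi 0, f p * ENNReal.ofReal (p ^ t) =
      ∫⁻ p in Ioi 0, g p * ENNReal.ofReal (p ^ t))
    (hfin : ∀ t ∈ Ioo u v, ∫⁻ p in Ioi 0, f p * ENNReal.ofReal (p ^ t) ≠ ⊤) :
    f =ᵐ[volume.restrict (Ioi 0)] g := by
  have h0 : (0 : ℝ) ∈ Ioo u v := ⟨hu, hv⟩
  have hf_fin : ∫⁻ p in Ioi (0 : ℝ), f p ≠ ⊤ := by simpa using hfin 0 h0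
  have hg_fin : ∫⁻ p in Ioi (0 : ℝ), g p ≠ ⊤ := by
    have := hfin 0 h0
    rw [h 0 h0] at this
    simpa using this
  refine (withDensity_eq_iff hf.aemeasurable hg.aemeasurable hf_fin).1 ?_
  have := isFiniteMeasure_withDensity hf_fin
  have := isFiniteMeasure_withDensity hg_fin
  have hexp : ∀ {k : ℝ → ENNReal}, Measurable k → ∀ t : ℝ,
      ∫⁻ p, ENNReal.ofReal (exp (t * log p)) ∂((volume.restrict (Ioi 0)).withDensity k) =
        ∫⁻ p in Ioi 0, k p * ENNReal.ofReal (p ^ t) := by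
    intro k hk t
    rw [lintegral_withDensity_eq_lintegral_mul _ hk (by fun_prop)]
    refine setLIntegral_congr_fun measurableSet_Ioi fun p hp => ?_
    simp only [Pi.mul_apply]
    rw [rpow_def_of_pos hp, mul_comm t]
  have hmap := map_eq_map_of_lintegral_exp_eq (μ := (volume.restrict (Ioi 0)).withDensity f)
    (ν := (volume.restrict (Ioi 0)).withDensity g) measurable_log hu hv
    (fun t ht => by rw [hexp hf, hexp hg, h t ht]) (fun t ht => by rw [hexp hf]; exact hfin t ht)
  have hback : ∀ k : ℝ → ENNReal,
      (((volume.restrict (Ioi (0 : ℝ))).withDensity k).map log).map exp =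
        (volume.restrict (Ioi 0)).withDensity k := by
    intro k
    rw [Measure.map_map measurable_exp measurable_log]
    conv_rhs => rw [← Measure.map_id (μ := (volume.restrict (Ioi (0 : ℝ))).withDensity k)]
    refine Measure.map_congr ?_
    refine (withDensity_absolutelyContinuous _ k).ae_le ?_
    filter_upwards [ae_restrict_mem measurableSet_Ioi] with p hp
    exact exp_log hp
  rw [← hback f, ← hback g, hmap]

lemma lintegral_rpow_mul_exp_neg_mul_rpow {k m r : ℝ} (hk : 0 < k) (hm : 0 < m) (hr : 0 < r) :
    ∫⁻ t in Ioi 0, ENNReal.ofReal (t ^ (k - 1) * exp (-r * t ^ m)) =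
      ENNReal.ofReal (r ^ (-k / m) * (1 / m) * Gamma (k / m)) := by
  rw [← ofReal_integral_eq_lintegral_ofReal
    (integrableOn_rpow_mul_exp_neg_mul_rpow (by linarith) hm hr),
    integral_rpow_mul_exp_neg_mul_rpow hm (by linarith) hr]
  · simp
  · filter_upwards [ae_restrict_mem measurableSet_Ioi] with t ht
    have : (0 : ℝ) < t := ht
    simp only [Pi.zero_apply]
    positivity

lemma lintegral_rpow_mul_exp_neg_mul {k r : ℝ} (hk : 0 < k) (hr : 0 < r) :
    ∫⁻ t in Ioi 0, ENNReal.ofReal (t ^ (k - 1) * exp (-r * t)) =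
      ENNReal.ofReal (r ^ (-k) * Gamma k) := by
  simpa using lintegral_rpow_mul_exp_neg_mul_rpow hk one_pos hr

/-- The Mellin transform of `(1 + p²)^(-α)`. -/
lemma lintegral_rpow_mul_one_add_sq_rpow {k α : ℝ} (hk : 0 < k) (hkα : k / 2 < α) :
    ∫⁻ p in Ioi 0, ENNReal.ofReal (p ^ (k - 1) * (1 + p ^ 2) ^ (-α)) =
      ENNReal.ofReal (Gamma (k / 2) * Gamma (α - k / 2) / (2 * Gamma α)) := by
  have hα : 0 < α := by linarith
  have hΓ := Gamma_pos_of_pos hα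
  have key : ∫⁻ p in Ioi (0 : ℝ), ∫⁻ t in Ioi (0 : ℝ),
        ENNReal.ofReal (p ^ (k - 1) * (t ^ (α - 1) * exp (-(1 + p ^ 2) * t))) =
      ∫⁻ t in Ioi (0 : ℝ), ∫⁻ p in Ioi (0 : ℝ),
        ENNReal.ofReal (p ^ (k - 1) * (t ^ (α - 1) * exp (-(1 + p ^ 2) * t))) :=
    lintegral_lintegral_swap (by fun_prop)
  have hL : ∫⁻ p in Ioi (0 : ℝ), ∫⁻ t in Ioi (0 : ℝ),
        ENNReal.ofReal (p ^ (k - 1) * (t ^ (α - 1) * exp (-(1 + p ^ 2) * t))) =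
      (∫⁻ p in Ioi 0, ENNReal.ofReal (p ^ (k - 1) * (1 + p ^ 2) ^ (-α))) *
        ENNReal.ofReal (Gamma α) := by
    rw [← lintegral_mul_const _ (by fun_prop)]
    refine setLIntegral_congr_fun measurableSet_Ioi fun p (hp : 0 < p) => ?_
    have hpk : 0 ≤ p ^ (k - 1) := by positivity
    simp only [ENNReal.ofReal_mul hpk]
    rw [lintegral_const_mul _ (by fun_prop), lintegral_rpow_mul_exp_neg_mul hα (by positivity),
      ENNReal.ofReal_mul (by positivity), mul_assoc]
  have hR : ∫⁻ t in Ioi (0 : ℝ), ∫⁻ p in Ioi (0 : ℝ),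
        ENNReal.ofReal (p ^ (k - 1) * (t ^ (α - 1) * exp (-(1 + p ^ 2) * t))) =
      ENNReal.ofReal (Gamma (α - k / 2)) * ENNReal.ofReal (1 / 2 * Gamma (k / 2)) := by
    have hinner : ∀ t ∈ Ioi (0 : ℝ), ∫⁻ p in Ioi (0 : ℝ),
          ENNReal.ofReal (p ^ (k - 1) * (t ^ (α - 1) * exp (-(1 + p ^ 2) * t))) =
        ENNReal.ofReal (t ^ ((α - k / 2) - 1) * exp (-1 * t)) *
          ENNReal.ofReal (1 / 2 * Gamma (k / 2)) := by
      intro t (ht : 0 < t)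
      have hG : 0 < Gamma (k / 2) := Gamma_pos_of_pos (by linarith)
      have hsplit : ∀ p : ℝ, p ^ (k - 1) * (t ^ (α - 1) * exp (-(1 + p ^ 2) * t)) =
          t ^ (α - 1) * exp (-t) * (p ^ (k - 1) * exp (-t * p ^ (2 : ℝ))) := by
        intro p
        rw [rpow_two, show -(1 + p ^ 2) * t = -t + -t * p ^ 2 by ring, exp_add]
        ring
      have hc : 0 ≤ t ^ (α - 1) * exp (-t) := by positivity
      simp only [hsplit, ENNReal.ofReal_mul hc]
      rw [lintegral_const_mul _ (by fun_prop),
        lintegral_rpow_mul_exp_neg_mul_rpow hk two_pos ht, ← ENNReal.ofReal_mul hc,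
        ← ENNReal.ofReal_mul (by positivity)]
      congr 1
      rw [show α - k / 2 - 1 = (α - 1) + (-k / 2) by ring, rpow_add ht]
      ring_nf
    rw [setLIntegral_congr_fun measurableSet_Ioi hinner, lintegral_mul_const _ (by fun_prop),
      lintegral_rpow_mul_exp_neg_mul (by linarith) one_pos]
    simp
  rw [hL, hR, ← ENNReal.ofReal_mul (Gamma_pos_of_pos (by linarith)).le] at key
  have hΓ' : ENNReal.ofReal (Gamma α) ≠ 0 := by simpa using hΓ
  rw [ENNReal.eq_div_iff hΓ' ENNReal.ofReal_ne_top |>.2 ((mul_comm _ _).trans key),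
    ← ENNReal.ofReal_div_of_pos hΓ]
  congr 1
  field_simp

lemma IsXLaw.ae_pos {a b c d : ℝ} {μ : Measure ℝ} (hμ : IsXLaw a b c d μ) : ∀ᵐ x ∂μ, 0 < x :=
  measure_eq_zero_iff_ae_notMem.1 hμ.2.1 |>.mono fun x hx => by simpa using hx

/-- If `X_{a,b,c,2}` exists, then `s ↦ Γ(c + 2s)` has no pole in `(-a, b)`. -/
lemma IsXLaw.two_mul_le {a b c : ℝ} (hb : 0 < b) (hc : 0 < c) {μ : Measure ℝ}
    (hμ : IsXLaw a b c 2 μ) : 2 * a ≤ c := by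
  by_contra! hlt
  have := hμ.1
  have hm := hμ.2.2 (-c / 2) ⟨by linarith, by linarith⟩
  rw [show c + 2 * (-c / 2) = 0 by ring, Gamma_zero, div_zero, mul_zero, ENNReal.ofReal_zero,
    lintegral_eq_zero_iff (by fun_prop)] at hm
  have : ∀ᵐ _ ∂μ, False := by
    filter_upwards [hm, hμ.ae_pos] with x hx hpos
    have : 0 < x ^ (-c / 2) := by positivity
    simp only [Pi.zero_apply, ENNReal.ofReal_eq_zero] at hx
    linarith
  simp [IsProbabilityMeasure.ne_zero μ] at this

/-- The Laplace transform of `X^(-1/2)`, weighted by `X^(-c/2)`. -/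
lemma IsXLaw.ae_lintegral_exp_eq {a b c : ℝ} (ha : 0 < a) (hb : 0 < b) (hc : 0 < c)
    {μ : Measure ℝ} (hμ : IsXLaw a b c 2 μ) :
    ∀ᵐ p ∂(volume.restrict (Ioi (0 : ℝ))),
      ∫⁻ x, ENNReal.ofReal (x ^ (-c / 2) * exp (-p * x ^ (-1 / 2 : ℝ))) ∂μ =
        ENNReal.ofReal (2 * Gamma c * Gamma (a + b) / (Gamma a * Gamma b) *
          (p ^ (2 * a - c) * (1 + p ^ 2) ^ (-(a + b)))) := by
  have := hμ.1
  have hac := hμ.two_mul_le hb hc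
  have hΓa := Gamma_pos_of_pos ha
  have hΓb := Gamma_pos_of_pos hb
  have hΓc := Gamma_pos_of_pos hc
  have hΓab := Gamma_pos_of_pos (add_pos ha hb)
  set K := 2 * Gamma c * Gamma (a + b) / (Gamma a * Gamma b) with hK
  have hKpos : 0 < K := by positivity
  set F : ℝ → ENNReal := fun p => ENNReal.ofReal (p ^ (c - 1)) *
    ∫⁻ x, ENNReal.ofReal (x ^ (-c / 2) * exp (-p * x ^ (-1 / 2 : ℝ))) ∂μ with hF
  set G : ℝ → ENNReal := fun p => ENNReal.ofReal (p ^ (c - 1)) *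
    ENNReal.ofReal (K * (p ^ (2 * a - c) * (1 + p ^ 2) ^ (-(a + b)))) with hG
  have hmeas : Measurable F := by
    refine Measurable.mul (by fun_prop) (Measurable.lintegral_prod_right' (f := fun z : ℝ × ℝ =>
      ENNReal.ofReal (z.2 ^ (-c / 2) * exp (-z.1 * z.2 ^ (-1 / 2 : ℝ)))) (by fun_prop))
  have hFt : ∀ t ∈ Ioo (-(2 * a)) (2 * b), ∫⁻ p in Ioi 0, F p * ENNReal.ofReal (p ^ t) =
      ENNReal.ofReal (Gamma c / (Gamma a * Gamma b) *
        (Gamma (a + t / 2) * Gamma (b - t / 2))) := by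
    intro t ht
    have hct : 0 < c + t := by linarith [ht.1]
    have hΓct := Gamma_pos_of_pos hct
    calc ∫⁻ p in Ioi 0, F p * ENNReal.ofReal (p ^ t)
        = ∫⁻ p in Ioi 0, ∫⁻ x, ENNReal.ofReal (x ^ (-c / 2)) *
            ENNReal.ofReal (p ^ (c + t - 1) * exp (-(x ^ (-1 / 2 : ℝ)) * p)) ∂μ := by
          refine setLIntegral_congr_fun measurableSet_Ioi fun p (hp : 0 < p) => ?_
          simp only [hF]
          rw [mul_right_comm, ← ENNReal.ofReal_mul (by positivity),
            ← lintegral_const_mul _ (by fun_prop)]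
          refine lintegral_congr_ae ?_
          filter_upwards [hμ.ae_pos] with x hx
          rw [← ENNReal.ofReal_mul (by positivity), ← ENNReal.ofReal_mul (by positivity),
            ← rpow_add hp]
          ring_nf
      _ = ∫⁻ x, (∫⁻ p in Ioi 0, ENNReal.ofReal (x ^ (-c / 2)) *
            ENNReal.ofReal (p ^ (c + t - 1) * exp (-(x ^ (-1 / 2 : ℝ)) * p))) ∂μ :=
          lintegral_lintegral_swap (by fun_prop)
      _ = ∫⁻ x, ENNReal.ofReal (x ^ (t / 2)) * ENNReal.ofReal (Gamma (c + t)) ∂μ := by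
          refine lintegral_congr_ae ?_
          filter_upwards [hμ.ae_pos] with x hx
          rw [lintegral_const_mul _ (by fun_prop),
            lintegral_rpow_mul_exp_neg_mul hct (by positivity), ← rpow_mul hx.le,
            ← ENNReal.ofReal_mul (by positivity), ← mul_assoc, ← rpow_add hx,
            ENNReal.ofReal_mul (by positivity)]
          ring_nf
      _ = _ := by
          have h1 : 0 < Gamma (a + t / 2) := Gamma_pos_of_pos (by linarith [ht.1])
          have h2 : 0 < Gamma (b - t / 2) := Gamma_pos_of_pos (by linarith [ht.2])
          rw [lintegral_mul_const _ (by fun_prop),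
            hμ.2.2 (t / 2) ⟨by linarith [ht.1], by linarith [ht.2]⟩,
            show c + 2 * (t / 2) = c + t by ring, ← ENNReal.ofReal_mul (by positivity)]
          congr 1
          field_simp
  have hGt : ∀ t ∈ Ioo (-(2 * a)) (2 * b), ∫⁻ p in Ioi 0, G p * ENNReal.ofReal (p ^ t) =
      ENNReal.ofReal (Gamma c / (Gamma a * Gamma b) *
        (Gamma (a + t / 2) * Gamma (b - t / 2))) := by
    intro t ht
    have hcongr : ∀ p ∈ Ioi (0 : ℝ), G p * ENNReal.ofReal (p ^ t) = ENNReal.ofReal K *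
        ENNReal.ofReal (p ^ ((2 * a + t) - 1) * (1 + p ^ 2) ^ (-(a + b))) := by
      intro p (hp : 0 < p)
      simp only [hG]
      rw [← ENNReal.ofReal_mul (by positivity), ← ENNReal.ofReal_mul (by positivity),
        ← ENNReal.ofReal_mul hKpos.le,
        show 2 * a + t - 1 = (c - 1) + (2 * a - c) + t by ring, rpow_add hp, rpow_add hp]
      ring_nf
    rw [setLIntegral_congr_fun measurableSet_Ioi hcongr, lintegral_const_mul _ (by fun_prop),
      lintegral_rpow_mul_one_add_sq_rpow (by linarith [ht.1]) (by linarith [ht.2]),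
      ← ENNReal.ofReal_mul hKpos.le, show (2 * a + t) / 2 = a + t / 2 by ring,
      show a + b - (a + t / 2) = b - t / 2 by ring]
    congr 1
    rw [hK]
    field_simp
  have hFG := ae_eq_of_lintegral_mul_rpow_eq hmeas (by fun_prop : Measurable G)
    (by linarith : -(2 * a) < 0) (by linarith : 0 < 2 * b)
    (fun t ht => by rw [hFt t ht, hGt t ht])
    (fun t ht => by rw [hFt t ht]; exact ENNReal.ofReal_ne_top)
  filter_upwards [hFG, ae_restrict_mem measurableSet_Ioi] with p hp (hp0 : 0 < p)
  refine (ENNReal.mul_right_inj ?_ ENNReal.ofReal_ne_top).1 hp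
  have : 0 < p ^ (c - 1) := by positivity
  simpa using this

/-- If the moment generating function of a measure is of the form
`p ↦ K p^k (1 + p²)^(-α)`, then the singularity at `p = ± I` is at most as strong as the one
at `p = 0`. -/
lemma add_nonpos_of_mgf_ae_eq {Ω : Type*} {m : MeasurableSpace Ω} {ν : Measure Ω} {Y : Ω → ℝ}
    {K k α : ℝ} (hK : 0 < K) (hint : Ioi 0 ⊆ integrableExpSet Y ν)
    (h : mgf Y ν =ᵐ[volume.restrict (Ioi 0)] fun p => K * (p ^ k * (1 + p ^ 2) ^ (-α))) :
    k + α ≤ 0 := by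
  have hint' : Ioi 0 ⊆ interior (integrableExpSet Y ν) := interior_maximal hint isOpen_Ioi
  have hreal : EqOn (mgf Y ν) (fun p => K * (p ^ k * (1 + p ^ 2) ^ (-α))) (Ioi 0) := by
    refine Measure.eqOn_open_of_ae_eq h isOpen_Ioi (continuousOn_mgf.mono hint') ?_
    refine continuousOn_const.mul (ContinuousOn.mul ?_ ?_)
    · exact continuousOn_id.rpow_const fun p hp => Or.inl (ne_of_gt hp)
    · exact (by fun_prop : ContinuousOn (fun p : ℝ => 1 + p ^ 2) (Ioi 0)).rpow_const
        fun p _ => Or.inl (by positivity)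
  have hslit : ∀ z : ℂ, 0 < z.re → 1 + z ^ 2 ∈ Complex.slitPlane := by
    intro z hz
    rw [Complex.mem_slitPlane_iff]
    by_cases him : z.im = 0
    · left
      simp [sq, him]
      positivity
    · right
      simp only [sq, Complex.add_im, Complex.one_im, Complex.mul_im, zero_add]
      intro h0
      have : z.re * z.im = 0 := by linarith
      simp [hz.ne', him] at this
  have hcomplex : EqOn (complexMGF Y ν)
      (fun z => (K : ℂ) * (z ^ (k : ℂ) * (1 + z ^ 2) ^ ((-α : ℝ) : ℂ))) {z | z.re ∈ Ioi 0} := by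
    refine eqOn_strip_of_eqOn_real isOpen_Ioi (convex_Ioi 0)
      (differentiableOn_complexMGF.mono fun z hz => hint' hz) ?_ ?_
    · intro z hz
      refine DifferentiableAt.differentiableWithinAt ?_
      refine (differentiableAt_const _).mul (DifferentiableAt.mul ?_ ?_)
      · exact differentiableAt_id.cpow_const (Or.inl hz)
      · exact DifferentiableAt.cpow_const (by fun_prop) (hslit z hz)
    · intro x (hx : 0 < x)
      rw [complexMGF_ofReal, hreal hx, ← Complex.ofReal_cpow hx.le,
        show (1 + (x : ℂ) ^ 2) = ((1 + x ^ 2 : ℝ) : ℂ) by push_cast; rfl,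
        ← Complex.ofReal_cpow (by positivity)]
      push_cast
      rfl
  have hbound : ∀ σ : ℝ, 0 < σ → ‖(σ + Complex.I : ℂ)‖ ^ k * ‖(σ + 2 * Complex.I : ℂ)‖ ^ (-α) ≤
      σ ^ (k + α) * (1 + σ ^ 2) ^ (-α) := by
    intro σ hσ
    have hle := norm_complexMGF_le_mgf (X := Y) (μ := ν) (z := (σ + Complex.I : ℂ))
    have hre : (σ + Complex.I : ℂ).re = σ := by simp
    rw [hcomplex (by simpa using hσ), hre, hreal hσ] at hle
    simp only [norm_mul, Complex.norm_cpow_real] at hle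
    rw [Complex.norm_of_nonneg hK.le, mul_le_mul_iff_right₀ hK,
      show (1 + (σ + Complex.I) ^ 2 : ℂ) = σ * (σ + 2 * Complex.I) by
        linear_combination Complex.I_sq, norm_mul, Complex.norm_of_nonneg hσ.le,
      mul_rpow hσ.le (norm_nonneg _)] at hle
    rw [rpow_add hσ]
    have hσα : σ ^ α * σ ^ (-α) = 1 := by rw [← rpow_add hσ]; simp
    have := mul_le_mul_of_nonneg_left hle (rpow_nonneg hσ.le α)
    calc _ = σ ^ α * σ ^ (-α) * (‖(σ + Complex.I : ℂ)‖ ^ k *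
          ‖(σ + 2 * Complex.I : ℂ)‖ ^ (-α)) := by rw [hσα, one_mul]
      _ = σ ^ α * (‖(σ + Complex.I : ℂ)‖ ^ k *
          (σ ^ (-α) * ‖(σ + 2 * Complex.I : ℂ)‖ ^ (-α))) := by ring
      _ ≤ _ := this
      _ = _ := by ring
  by_contra! hpos
  have hlim : (2 : ℝ) ^ (-α) ≤ 0 := by
    have hl : Filter.Tendsto
        (fun σ : ℝ => ‖(σ + Complex.I : ℂ)‖ ^ k * ‖(σ + 2 * Complex.I : ℂ)‖ ^ (-α))
        (nhdsWithin 0 (Ioi 0)) (nhds (1 ^ k * 2 ^ (-α))) := by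
      refine Filter.Tendsto.mono_left ?_ nhdsWithin_le_nhds
      refine (Filter.Tendsto.rpow_const ?_ (Or.inl one_ne_zero)).mul
        (Filter.Tendsto.rpow_const ?_ (Or.inl two_ne_zero))
      · exact Continuous.tendsto' (by fun_prop) _ _ (by simp)
      · exact Continuous.tendsto' (by fun_prop) _ _ (by simp)
    have hr : Filter.Tendsto (fun σ : ℝ => σ ^ (k + α) * (1 + σ ^ 2) ^ (-α))
        (nhdsWithin 0 (Ioi 0)) (nhds (0 * 1 ^ (-α))) := by
      refine Filter.Tendsto.mono_left ?_ nhdsWithin_le_nhds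
      refine Filter.Tendsto.mul ?_ (Filter.Tendsto.rpow_const ?_ (Or.inl one_ne_zero))
      · exact (continuous_rpow_const hpos.le).tendsto' _ _ (zero_rpow hpos.ne')
      · exact Continuous.tendsto' (by fun_prop) _ _ (by simp)
    have := le_of_tendsto_of_tendsto hl hr
      (Filter.eventually_of_mem self_mem_nhdsWithin fun σ hσ => hbound σ hσ)
    simpa using this
  exact absurd hlim (not_le.2 (by positivity))

theorem XExists_not_of_three_a_add_b_gt (a b c : ℝ) (ha : 0 < a) (hb : 0 < b) (hc : 0 < c)
    (h : c < 3 * a + b) : ¬ XExists a b c 2 := by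
  rintro ⟨μ, hμ⟩
  have hΓa := Gamma_pos_of_pos ha
  have hΓb := Gamma_pos_of_pos hb
  have hΓc := Gamma_pos_of_pos hc
  have hΓab := Gamma_pos_of_pos (add_pos ha hb)
  set ν : Measure ℝ := μ.withDensity fun x => ENNReal.ofReal (x ^ (-c / 2))
  set Y : ℝ → ℝ := fun x => -(x ^ (-1 / 2 : ℝ))
  have hY : Measurable Y := by fun_prop
  have hνY : ∀ p : ℝ, ∫⁻ x, ENNReal.ofReal (exp (p * Y x)) ∂ν =
      ∫⁻ x, ENNReal.ofReal (x ^ (-c / 2) * exp (-p * x ^ (-1 / 2 : ℝ))) ∂μ := by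
    intro p
    rw [lintegral_withDensity_eq_lintegral_mul _ (by fun_prop) (by fun_prop)]
    refine lintegral_congr_ae ?_
    filter_upwards [hμ.ae_pos] with x hx
    simp only [Pi.mul_apply, Y]
    rw [← ENNReal.ofReal_mul (by positivity), mul_neg, neg_mul]
  have hae := hμ.ae_lintegral_exp_eq ha hb hc
  simp only [← hνY] at hae
  have hint : Ioi 0 ⊆ integrableExpSet Y ν := by
    intro p (hp : 0 < p)
    obtain ⟨q, ⟨hq0, hqp⟩, hq⟩ : ∃ q ∈ Ioo 0 p, ∫⁻ x, ENNReal.ofReal (exp (q * Y x)) ∂ν ≠ ⊤ := by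
      have hae' := ae_restrict_of_ae_restrict_of_subset
        (Ioo_subset_Ioi_self : Ioo 0 p ⊆ Ioi (0 : ℝ)) hae
      have : Filter.NeBot (ae (volume.restrict (Ioo 0 p))) := by
        rw [ae_neBot, Ne, Measure.restrict_eq_zero]
        simp [hp]
      obtain ⟨q, hq, hqm⟩ := (hae'.and (ae_restrict_mem measurableSet_Ioo)).exists
      exact ⟨q, hqm, hq ▸ ENNReal.ofReal_ne_top⟩
    refine mem_integrableExpSet_of_lintegral_ne_top hY.aemeasurable (ne_top_of_le_ne_top hq ?_)
    refine lintegral_mono_ae ?_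
    filter_upwards [(withDensity_absolutelyContinuous μ _).ae_le hμ.ae_pos] with x hx
    have : 0 ≤ x ^ (-1 / 2 : ℝ) := by positivity
    refine ENNReal.ofReal_le_ofReal (exp_le_exp.2 ?_)
    simp only [Y]
    nlinarith
  have := add_nonpos_of_mgf_ae_eq (k := 2 * a - c) (α := a + b)
    (K := 2 * Gamma c * Gamma (a + b) / (Gamma a * Gamma b))
    (by positivity) hint (by
      filter_upwards [hae, ae_restrict_mem measurableSet_Ioi] with p hp (hp0 : 0 < p)
      rw [mgf_eq_toReal_lintegral hY.aemeasurable, hp, ENNReal.toReal_ofReal (by positivity)])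
  linarith
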